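/- Suppose W is an m×m real symmetric matrix with nonnegative entries and positive diagonal entries, κ_1,…,κ_m > 0, c ≥ 0, c̄ > 0, and E is invertible. Then for any complex number λ ≠ 1, λ is an eigenvalue of Q = E⁻¹ F if and only if there exists a nonzero vector u ∈ ℂ^{mn} with M(λ) u = 0, where M(λ) = λ² M₂ + λ M₁ + M₀ (with the real matrices M₀, M₁, M₂ complexified entrywise). -/

import Mathlib

open Matrix
open scoped Kronecker

noncomputable section

/-- `M̄ = M ⊗ I_n`. -/
def bar (n : ℕ) {m : ℕ} (M : Matrix (Fin m) (Fin m) ℝ) :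
    Matrix (Fin m × Fin n) (Fin m × Fin n) ℝ :=
  M ⊗ₖ (1 : Matrix (Fin n) (Fin n) ℝ)

/-- `D`: the diagonal matrix of row sums of `W`. -/
def rowSumDiag {m : ℕ} (W : Matrix (Fin m) (Fin m) ℝ) : Matrix (Fin m) (Fin m) ℝ :=
  Matrix.diagonal fun i => ∑ j, W i j

/-- `Ā = blockdiag(A_1, …, A_m)`. -/
def blockDiag {m n : ℕ} (ni : Fin m → ℕ) (A : ∀ i, Matrix (Fin (ni i)) (Fin n) ℝ) :
    Matrix ((i : Fin m) × Fin (ni i)) (Fin m × Fin n) ℝ :=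
  fun p q => if p.1 = q.1 then A p.1 p.2 q.2 else 0

/-- `b = col(b_1, …, b_m)`. -/
def bvec {m : ℕ} {ni : Fin m → ℕ} (b : ∀ i, Fin (ni i) → ℝ) :
    (i : Fin m) × Fin (ni i) → ℝ := fun p => b p.1 p.2

/-- The block matrix `E`. -/
def Emat {m n : ℕ} (ni : Fin m → ℕ) (A : ∀ i, Matrix (Fin (ni i)) (Fin n) ℝ)
    (W : Matrix (Fin m) (Fin m) ℝ) (κ : Fin m → ℝ) (c cbar : ℝ) :
    Matrix ((Fin m × Fin n) ⊕ (Fin m × Fin n)) ((Fin m × Fin n) ⊕ (Fin m × Fin n)) ℝ :=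
  Matrix.fromBlocks
    (1 + cbar • (bar n (Matrix.diagonal κ) * ((blockDiag ni A)ᵀ * blockDiag ni A))
       + c • (bar n (Matrix.diagonal κ) * bar n (rowSumDiag W)))
    (bar n (Matrix.diagonal κ) * bar n (rowSumDiag W))
    (-(bar n (Matrix.diagonal κ) * bar n (rowSumDiag W)))
    1

/-- The block matrix `F`. -/
def Fmat (n : ℕ) {m : ℕ} (W : Matrix (Fin m) (Fin m) ℝ) (κ : Fin m → ℝ) (c : ℝ) :
    Matrix ((Fin m × Fin n) ⊕ (Fin m × Fin n)) ((Fin m × Fin n) ⊕ (Fin m × Fin n)) ℝ :=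
  Matrix.fromBlocks
    (1 + c • (bar n (Matrix.diagonal κ) * bar n W))
    (bar n (Matrix.diagonal κ) * bar n W)
    (-(bar n (Matrix.diagonal κ) * bar n W))
    1

/-- `M₂ = D̄K̄D̄ + K̄⁻¹ + cD̄ + c̄Ā'Ā`. -/
def M2mat {m n : ℕ} (ni : Fin m → ℕ) (A : ∀ i, Matrix (Fin (ni i)) (Fin n) ℝ)
    (W : Matrix (Fin m) (Fin m) ℝ) (κ : Fin m → ℝ) (c cbar : ℝ) :
    Matrix (Fin m × Fin n) (Fin m × Fin n) ℝ :=
  bar n (rowSumDiag W) * bar n (Matrix.diagonal κ) * bar n (rowSumDiag W)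
    + (bar n (Matrix.diagonal κ))⁻¹ + c • bar n (rowSumDiag W)
    + cbar • ((blockDiag ni A)ᵀ * blockDiag ni A)

/-- `M₁ = −W̄K̄D̄ − D̄K̄W̄ − 2K̄⁻¹ − cD̄ − cW̄ − c̄Ā'Ā`. -/
def M1mat {m n : ℕ} (ni : Fin m → ℕ) (A : ∀ i, Matrix (Fin (ni i)) (Fin n) ℝ)
    (W : Matrix (Fin m) (Fin m) ℝ) (κ : Fin m → ℝ) (c cbar : ℝ) :
    Matrix (Fin m × Fin n) (Fin m × Fin n) ℝ :=
  -(bar n W * bar n (Matrix.diagonal κ) * bar n (rowSumDiag W))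
    - bar n (rowSumDiag W) * bar n (Matrix.diagonal κ) * bar n W
    - (2 : ℝ) • (bar n (Matrix.diagonal κ))⁻¹
    - c • bar n (rowSumDiag W) - c • bar n W
    - cbar • ((blockDiag ni A)ᵀ * blockDiag ni A)

/-- `M₀ = W̄K̄W̄ + K̄⁻¹ + cW̄`. -/
def M0mat (n : ℕ) {m : ℕ}
    (W : Matrix (Fin m) (Fin m) ℝ) (κ : Fin m → ℝ) (c : ℝ) :
    Matrix (Fin m × Fin n) (Fin m × Fin n) ℝ :=
  bar n W * bar n (Matrix.diagonal κ) * bar n W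
    + (bar n (Matrix.diagonal κ))⁻¹ + c • bar n W

namespace Matrix

/-- A block matrix `[[X, B], [-B, μ]]` with `μ ≠ 0` is singular iff its Schur complement is. -/
theorem exists_mulVec_fromBlocks_eq_zero_iff {ι 𝕜 : Type*} [Fintype ι] [DecidableEq ι] [Field 𝕜]
    (X B : Matrix ι ι 𝕜) {μ : 𝕜} (hμ : μ ≠ 0) :
    (∃ v : ι ⊕ ι → 𝕜, v ≠ 0 ∧ fromBlocks X B (-B) (μ • 1) *ᵥ v = 0) ↔
      ∃ u : ι → 𝕜, u ≠ 0 ∧ (μ • X + B * B) *ᵥ u = 0 := by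
  constructor
  · rintro ⟨v, hv, h⟩
    have htop : X *ᵥ (v ∘ Sum.inl) + B *ᵥ (v ∘ Sum.inr) = 0 := by
      rw [fromBlocks_mulVec] at h
      exact funext fun i => congrFun h (Sum.inl i)
    have hbot : μ • (v ∘ Sum.inr) = B *ᵥ (v ∘ Sum.inl) := by
      have : (-B) *ᵥ (v ∘ Sum.inl) + (μ • (1 : Matrix ι ι 𝕜)) *ᵥ (v ∘ Sum.inr) = 0 := by
        rw [fromBlocks_mulVec] at h
        exact funext fun i => congrFun h (Sum.inr i)
      rwa [neg_mulVec, smul_mulVec, one_mulVec, neg_add_eq_zero, eq_comm] at this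
    refine ⟨v ∘ Sum.inl, fun hx => hv ?_, ?_⟩
    · rw [hx, mulVec_zero, smul_eq_zero_iff_right hμ] at hbot
      rw [← Sum.elim_comp_inl_inr v, hx, hbot, Sum.elim_zero_zero]
    · rw [add_mulVec, ← mulVec_mulVec, ← hbot, smul_mulVec, mulVec_smul, ← smul_add, htop,
        smul_zero]
  · rintro ⟨u, hu, h⟩
    refine ⟨Sum.elim u (μ⁻¹ • B *ᵥ u), fun h0 => hu ?_, ?_⟩
    · exact funext fun i => congrFun h0 (Sum.inl i)
    · have htop : X *ᵥ u + μ⁻¹ • B *ᵥ (B *ᵥ u) = 0 := by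
        have := congrArg (μ⁻¹ • ·) h
        simpa [add_mulVec, smul_mulVec, smul_add, smul_smul, hμ, ← mulVec_mulVec] using this
      rw [fromBlocks_mulVec, Sum.elim_comp_inl, Sum.elim_comp_inr, mulVec_smul, htop]
      simp [neg_mulVec, smul_mulVec, smul_smul, hμ]

theorem exists_mulVec_mul_eq_zero_iff {ι R : Type*} [Fintype ι] [DecidableEq ι] [CommRing R]
    {K Ki : Matrix ι ι R} (h : Ki * K = 1) (M : Matrix ι ι R) :
    (∃ u : ι → R, u ≠ 0 ∧ (K * M) *ᵥ u = 0) ↔ ∃ u : ι → R, u ≠ 0 ∧ M *ᵥ u = 0 := by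
  refine exists_congr fun u => and_congr_right fun _ => ⟨fun hu => ?_, fun hu => ?_⟩
  · rw [← one_mul M, ← h, mul_assoc, ← mulVec_mulVec, hu, mulVec_zero]
  · rw [← mulVec_mulVec, hu, mulVec_zero]

theorem map_ofReal_smul {ι ι' : Type*} (r : ℝ) (M : Matrix ι ι' ℝ) :
    (r • M).map Complex.ofRealHom = (r : ℂ) • M.map Complex.ofRealHom := by
  ext; simp

theorem inv_mul_map_ofReal_mulVec_eq_smul_iff {ι : Type*} [Fintype ι] [DecidableEq ι]
    {E : Matrix ι ι ℝ} (hE : IsUnit E) (F : Matrix ι ι ℝ) (l : ℂ) (v : ι → ℂ) :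
    (E⁻¹ * F).map Complex.ofRealHom *ᵥ v = l • v ↔
      (l • E.map Complex.ofRealHom - F.map Complex.ofRealHom) *ᵥ v = 0 := by
  have hdet := (isUnit_iff_isUnit_det E).1 hE
  have h₁ : E.map Complex.ofRealHom * E⁻¹.map Complex.ofRealHom = 1 := by
    rw [← Matrix.map_mul, mul_nonsing_inv E hdet]; simp
  have h₂ : E⁻¹.map Complex.ofRealHom * E.map Complex.ofRealHom = 1 := by
    rw [← Matrix.map_mul, nonsing_inv_mul E hdet]; simp
  rw [Matrix.map_mul, sub_mulVec, smul_mulVec, sub_eq_zero]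
  constructor
  · intro h
    rw [← mulVec_smul, ← h, mulVec_mulVec, ← mul_assoc, h₁, one_mul]
  · intro h
    rw [← mulVec_mulVec, ← h, mulVec_smul, mulVec_mulVec, h₂, one_mulVec]

end Matrix

theorem isUnit_bar_diagonal {m : ℕ} (n : ℕ) {κ : Fin m → ℝ} (hκ : ∀ i, κ i ≠ 0) :
    IsUnit (bar n (diagonal κ)) := by
  rw [bar, ← diagonal_one, diagonal_kronecker_diagonal, isUnit_diagonal, Pi.isUnit_iff]
  simp [hκ]

/-- The pencil `lE - F`, in block form. -/
theorem smul_Emat_sub_Fmat {m n : ℕ} (ni : Fin m → ℕ) (A : ∀ i, Matrix (Fin (ni i)) (Fin n) ℝ)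
    (W : Matrix (Fin m) (Fin m) ℝ) (κ : Fin m → ℝ) (c cbar : ℝ) (l : ℂ)
    {K D V P : Matrix (Fin m × Fin n) (Fin m × Fin n) ℂ}
    (hK : (bar n (diagonal κ)).map Complex.ofRealHom = K)
    (hD : (bar n (rowSumDiag W)).map Complex.ofRealHom = D)
    (hV : (bar n W).map Complex.ofRealHom = V)
    (hP : ((blockDiag ni A)ᵀ * blockDiag ni A).map Complex.ofRealHom = P) :
    l • (Emat ni A W κ c cbar).map Complex.ofRealHom - (Fmat n W κ c).map Complex.ofRealHom =
      fromBlocks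
        ((l - 1) • 1 + (l * cbar) • (K * P) + (c : ℂ) • (K * (l • D - V)))
        (K * (l • D - V)) (-(K * (l • D - V))) ((l - 1) • 1) := by
  have hone : (1 : Matrix (Fin m × Fin n) (Fin m × Fin n) ℝ).map Complex.ofRealHom = 1 := by
    simp
  have hneg (M : Matrix (Fin m × Fin n) (Fin m × Fin n) ℝ) :
      (-M).map Complex.ofRealHom = -M.map Complex.ofRealHom := by ext; simp
  have hmul (M : Matrix (Fin m × Fin n) (Fin m × Fin n) ℝ) :
      (bar n (diagonal κ) * M).map Complex.ofRealHom = K * M.map Complex.ofRealHom := by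
    rw [Matrix.map_mul, hK]
  rw [Emat, Fmat]
  simp only [fromBlocks_map, fromBlocks_smul, sub_eq_add_neg, fromBlocks_neg, fromBlocks_add,
    Matrix.map_add _ (map_add Complex.ofRealHom), map_ofReal_smul, hneg, hone]
  simp only [hmul, hD, hV, hP, mul_add, mul_neg,
    mul_smul_comm]
  congr 1 <;> module

/-- The Schur complement of the pencil is `K` times the quadratic matrix polynomial. -/
theorem schur_eq_mul_quadratic {ι : Type*} [Fintype ι] [DecidableEq ι]
    {K Ki : Matrix ι ι ℂ} (D V P : Matrix ι ι ℂ) (h : K * Ki = 1) (c cbar l : ℂ) :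
    (l - 1) • ((l - 1) • 1 + (l * cbar) • (K * P) + c • (K * (l • D - V)))
        + K * (l • D - V) * (K * (l • D - V)) =
      K * (l ^ 2 • (D * K * D + Ki + c • D + cbar • P)
        + l • (-(V * K * D) - D * K * V - (2 : ℂ) • Ki - c • D - c • V - cbar • P)
        + (V * K * V + Ki + c • V)) := by
  simp only [mul_add, mul_sub, sub_mul, mul_neg, mul_smul_comm, smul_mul_assoc, h, mul_assoc]
  module

theorem stmt8 (m n : ℕ) (ni : Fin m → ℕ)
    (A : ∀ i, Matrix (Fin (ni i)) (Fin n) ℝ)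
    (W : Matrix (Fin m) (Fin m) ℝ) (κ : Fin m → ℝ) (c cbar : ℝ)
    (hWsymm : W.IsSymm) (hWnn : ∀ i j, 0 ≤ W i j) (hWdiag : ∀ i, 0 < W i i)
    (hκ : ∀ i, 0 < κ i) (hc : 0 ≤ c) (hcbar : 0 < cbar)
    (hE : IsUnit (Emat ni A W κ c cbar))
    (lam : ℂ) (hlam : lam ≠ 1) :
    (∃ v : ((Fin m × Fin n) ⊕ (Fin m × Fin n)) → ℂ, v ≠ 0 ∧
      (((Emat ni A W κ c cbar)⁻¹ * Fmat n W κ c).map (fun a => (a : ℂ))).mulVec v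
        = lam • v) ↔
    (∃ u : Fin m × Fin n → ℂ, u ≠ 0 ∧
      (lam ^ 2 • (M2mat ni A W κ c cbar).map (fun a => (a : ℂ))
        + lam • (M1mat ni A W κ c cbar).map (fun a => (a : ℂ))
        + (M0mat n W κ c).map (fun a => (a : ℂ))).mulVec u = 0) := by
  have hK := (isUnit_iff_isUnit_det _).1 (isUnit_bar_diagonal n fun i => (hκ i).ne')
  have h₁ : (bar n (diagonal κ)).map Complex.ofRealHom
      * (bar n (diagonal κ))⁻¹.map Complex.ofRealHom = 1 := by
    rw [← Matrix.map_mul, mul_nonsing_inv _ hK]; simp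
  have hneg (M : Matrix (Fin m × Fin n) (Fin m × Fin n) ℝ) :
      (-M).map Complex.ofRealHom = -M.map Complex.ofRealHom := by ext; simp
  change (∃ v : ((Fin m × Fin n) ⊕ (Fin m × Fin n)) → ℂ, v ≠ 0 ∧
      ((Emat ni A W κ c cbar)⁻¹ * Fmat n W κ c).map Complex.ofRealHom *ᵥ v = lam • v) ↔
    (∃ u : Fin m × Fin n → ℂ, u ≠ 0 ∧
      (lam ^ 2 • (M2mat ni A W κ c cbar).map Complex.ofRealHom
        + lam • (M1mat ni A W κ c cbar).map Complex.ofRealHom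
        + (M0mat n W κ c).map Complex.ofRealHom) *ᵥ u = 0)
  simp only [inv_mul_map_ofReal_mulVec_eq_smul_iff hE,
    smul_Emat_sub_Fmat ni A W κ c cbar lam rfl rfl rfl rfl]
  rw [exists_mulVec_fromBlocks_eq_zero_iff _ _ (sub_ne_zero.2 hlam),
    schur_eq_mul_quadratic _ _ _ h₁, exists_mulVec_mul_eq_zero_iff (mul_eq_one_comm.1 h₁),
    M2mat, M1mat, M0mat]
  simp only [Matrix.map_add _ (map_add Complex.ofRealHom),
    Matrix.map_sub _ (map_sub Complex.ofRealHom), map_ofReal_smul, hneg, Matrix.map_mul,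
    Complex.ofReal_ofNat]
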